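/- ΣB-deduction theorem: let T be any extension of PA(K4) and X any set of ΣB sentences. Then for any L_□-formula φ, if T + X ⊢ φ, then there exist σ₀, …, σ_{k−1} ∈ X such that T ⊢ σ₀ ∧ ⋯ ∧ σ_{k−1} → φ. -/

import Mathlib

namespace ModalArith

/-- Terms of the language of arithmetic L_A = {0, S, +, ×, ≤, =}. -/
inductive Term : Type
  | var : ℕ → Term
  | zero : Term
  | succ : Term → Term
  | add : Term → Term → Term
  | mul : Term → Term → Term
  deriving DecidableEq

namespace Term

/-- Free variables of a term. -/
def fv : Term → Finset ℕ
  | var x => {x}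
  | zero => ∅
  | succ t => fv t
  | add t u => fv t ∪ fv u
  | mul t u => fv t ∪ fv u

/-- Simultaneous substitution of terms for variables. -/
def substAll : Term → (ℕ → Term) → Term
  | var x, v => v x
  | zero, _ => zero
  | succ t, v => succ (substAll t v)
  | add t u, v => add (substAll t v) (substAll u v)
  | mul t u, v => mul (substAll t v) (substAll u v)

/-- Substitution of the term `s` for the variable `x`. -/
def subst (x : ℕ) (s : Term) (t : Term) : Term :=
  substAll t (Function.update Term.var x s)

/-- The numeral `n̄`. -/
def numeral : ℕ → Term
  | 0 => zero
  | n + 1 => succ (numeral n)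

/-- Value of a term in the standard model under a valuation. -/
def val : Term → (ℕ → ℕ) → ℕ
  | var x, v => v x
  | zero, _ => 0
  | succ t, v => val t v + 1
  | add t u, v => val t v + val u v
  | mul t u, v => val t v * val u v

/-- A Gödel numbering of terms. -/
def code : Term → ℕ
  | var x => Nat.pair 0 x
  | zero => Nat.pair 1 0
  | succ t => Nat.pair 2 (code t)
  | add t u => Nat.pair 3 (Nat.pair (code t) (code u))
  | mul t u => Nat.pair 4 (Nat.pair (code t) (code u))

end Term

/-- Formulas of the language L_□ of modal arithmetic. -/
inductive Formula : Type
  | falsum : Formula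
  | eq : Term → Term → Formula
  | le : Term → Term → Formula
  | and : Formula → Formula → Formula
  | or : Formula → Formula → Formula
  | imp : Formula → Formula → Formula
  | neg : Formula → Formula
  | all : ℕ → Formula → Formula
  | ex : ℕ → Formula → Formula
  | box : Formula → Formula
  deriving DecidableEq

namespace Formula

/-- Free variables of a formula. -/
def fv : Formula → Finset ℕ
  | falsum => ∅
  | eq t u => t.fv ∪ u.fv
  | le t u => t.fv ∪ u.fv
  | and φ ψ => fv φ ∪ fv ψ
  | or φ ψ => fv φ ∪ fv ψ
  | imp φ ψ => fv φ ∪ fv ψ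
  | neg φ => fv φ
  | all x φ => (fv φ).erase x
  | ex x φ => (fv φ).erase x
  | box φ => fv φ

/-- Simultaneous substitution of terms for the free variables of a formula. -/
def substAll : Formula → (ℕ → Term) → Formula
  | falsum, _ => falsum
  | eq t u, v => eq (t.substAll v) (u.substAll v)
  | le t u, v => le (t.substAll v) (u.substAll v)
  | and φ ψ, v => and (substAll φ v) (substAll ψ v)
  | or φ ψ, v => or (substAll φ v) (substAll ψ v)
  | imp φ ψ, v => imp (substAll φ v) (substAll ψ v)
  | neg φ, v => neg (substAll φ v)
  | all x φ, v => all x (substAll φ (Function.update v x (Term.var x)))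
  | ex x φ, v => ex x (substAll φ (Function.update v x (Term.var x)))
  | box φ, v => box (substAll φ v)

/-- Substitution of the term `s` for the free occurrences of the variable `x`. -/
def subst (x : ℕ) (s : Term) (φ : Formula) : Formula :=
  substAll φ (Function.update Term.var x s)

/-- The term `s` is substitutable (free) for the variable `x` in the formula. -/
def freeFor (s : Term) (x : ℕ) : Formula → Prop
  | falsum => True
  | eq _ _ => True
  | le _ _ => True
  | and φ ψ => freeFor s x φ ∧ freeFor s x ψ
  | or φ ψ => freeFor s x φ ∧ freeFor s x ψ
  | imp φ ψ => freeFor s x φ ∧ freeFor s x ψ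
  | neg φ => freeFor s x φ
  | all y φ => x = y ∨ x ∉ fv φ ∨ (y ∉ s.fv ∧ freeFor s x φ)
  | ex y φ => x = y ∨ x ∉ fv φ ∨ (y ∉ s.fv ∧ freeFor s x φ)
  | box φ => freeFor s x φ

/-- The formula is an L_A-formula (contains no □). -/
def noBox : Formula → Prop
  | falsum => True
  | eq _ _ => True
  | le _ _ => True
  | and φ ψ => noBox φ ∧ noBox ψ
  | or φ ψ => noBox φ ∧ noBox ψ
  | imp φ ψ => noBox φ ∧ noBox ψ
  | neg φ => noBox φ
  | all _ φ => noBox φ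
  | ex _ φ => noBox φ
  | box _ => False

/-- Truth in the standard model ℕ under a valuation (meaningful for L_A-formulas;
boxed formulas are given the dummy value `False`). -/
def val : Formula → (ℕ → ℕ) → Prop
  | falsum, _ => False
  | eq t u, v => t.val v = u.val v
  | le t u, v => t.val v ≤ u.val v
  | and φ ψ, v => val φ v ∧ val ψ v
  | or φ ψ, v => val φ v ∨ val ψ v
  | imp φ ψ, v => val φ v → val ψ v
  | neg φ, v => ¬ val φ v
  | all x φ, v => ∀ n : ℕ, val φ (Function.update v x n)
  | ex x φ, v => ∃ n : ℕ, val φ (Function.update v x n)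
  | box _, _ => False

/-- Biconditional, as an abbreviation. -/
def iff (φ ψ : Formula) : Formula := (φ.imp ψ).and (ψ.imp φ)

/-- `t < u` abbreviates `S t ≤ u`. -/
def lt (t u : Term) : Formula := le (Term.succ t) u

/-- Bounded universal quantification `∀ x < t, φ`. -/
def ball (x : ℕ) (t : Term) (φ : Formula) : Formula :=
  all x ((lt (Term.var x) t).imp φ)

/-- Bounded existential quantification `∃ x < t, φ`. -/
def bex (x : ℕ) (t : Term) (φ : Formula) : Formula :=
  ex x ((lt (Term.var x) t).and φ)

/-- A Gödel numbering of formulas. -/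
def code : Formula → ℕ
  | falsum => Nat.pair 0 0
  | eq t u => Nat.pair 1 (Nat.pair t.code u.code)
  | le t u => Nat.pair 2 (Nat.pair t.code u.code)
  | and φ ψ => Nat.pair 3 (Nat.pair (code φ) (code ψ))
  | or φ ψ => Nat.pair 4 (Nat.pair (code φ) (code ψ))
  | imp φ ψ => Nat.pair 5 (Nat.pair (code φ) (code ψ))
  | neg φ => Nat.pair 6 (code φ)
  | all x φ => Nat.pair 7 (Nat.pair x (code φ))
  | ex x φ => Nat.pair 8 (Nat.pair x (code φ))
  | box φ => Nat.pair 9 (code φ)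

end Formula

/-- A sentence is a formula with no free variables. -/
def Sentence (φ : Formula) : Prop := φ.fv = ∅

/-- Truth in the standard model ℕ (for sentences; any fixed valuation will do). -/
def StdTrue (φ : Formula) : Prop := φ.val fun _ => 0

/-- The logical axioms of classical first-order logic with equality for L_□,
with the identity axioms only for atomic formulas. -/
inductive LogicalAxiom : Formula → Prop
  | imp1 (φ ψ : Formula) : LogicalAxiom (φ.imp (ψ.imp φ))
  | imp2 (φ ψ χ : Formula) :
      LogicalAxiom ((φ.imp (ψ.imp χ)).imp ((φ.imp ψ).imp (φ.imp χ)))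
  | dne (φ : Formula) : LogicalAxiom (φ.neg.neg.imp φ)
  | negI (φ ψ : Formula) : LogicalAxiom ((φ.imp ψ).imp ((φ.imp ψ.neg).imp φ.neg))
  | negE (φ ψ : Formula) : LogicalAxiom (φ.neg.imp (φ.imp ψ))
  | falsumE (φ : Formula) : LogicalAxiom (Formula.falsum.imp φ)
  | negIntro (φ : Formula) : LogicalAxiom ((φ.imp Formula.falsum).imp φ.neg)
  | negElimFalsum (φ : Formula) : LogicalAxiom (φ.neg.imp (φ.imp Formula.falsum))
  | andI (φ ψ : Formula) : LogicalAxiom (φ.imp (ψ.imp (φ.and ψ)))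
  | andE1 (φ ψ : Formula) : LogicalAxiom ((φ.and ψ).imp φ)
  | andE2 (φ ψ : Formula) : LogicalAxiom ((φ.and ψ).imp ψ)
  | orI1 (φ ψ : Formula) : LogicalAxiom (φ.imp (φ.or ψ))
  | orI2 (φ ψ : Formula) : LogicalAxiom (ψ.imp (φ.or ψ))
  | orE (φ ψ χ : Formula) :
      LogicalAxiom ((φ.imp χ).imp ((ψ.imp χ).imp ((φ.or ψ).imp χ)))
  | allE (x : ℕ) (t : Term) (φ : Formula) :
      φ.freeFor t x → LogicalAxiom ((Formula.all x φ).imp (φ.subst x t))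
  | allImp (x : ℕ) (φ ψ : Formula) :
      x ∉ φ.fv → LogicalAxiom ((Formula.all x (φ.imp ψ)).imp (φ.imp (Formula.all x ψ)))
  | exI (x : ℕ) (t : Term) (φ : Formula) :
      φ.freeFor t x → LogicalAxiom ((φ.subst x t).imp (Formula.ex x φ))
  | exE (x : ℕ) (φ ψ : Formula) :
      x ∉ ψ.fv → LogicalAxiom ((Formula.all x (φ.imp ψ)).imp ((Formula.ex x φ).imp ψ))
  | eqRefl (t : Term) : LogicalAxiom (Formula.eq t t)
  | eqSymm (t u : Term) : LogicalAxiom ((Formula.eq t u).imp (Formula.eq u t))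
  | eqTrans (t u w : Term) :
      LogicalAxiom ((Formula.eq t u).imp ((Formula.eq u w).imp (Formula.eq t w)))
  | eqSucc (t u : Term) :
      LogicalAxiom ((Formula.eq t u).imp (Formula.eq t.succ u.succ))
  | eqAdd (t₁ t₂ u₁ u₂ : Term) :
      LogicalAxiom ((Formula.eq t₁ t₂).imp ((Formula.eq u₁ u₂).imp
        (Formula.eq (t₁.add u₁) (t₂.add u₂))))
  | eqMul (t₁ t₂ u₁ u₂ : Term) :
      LogicalAxiom ((Formula.eq t₁ t₂).imp ((Formula.eq u₁ u₂).imp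
        (Formula.eq (t₁.mul u₁) (t₂.mul u₂))))
  | eqLe (t₁ t₂ u₁ u₂ : Term) :
      LogicalAxiom ((Formula.eq t₁ t₂).imp ((Formula.eq u₁ u₂).imp
        ((Formula.le t₁ u₁).imp (Formula.le t₂ u₂))))

/-- Provability in an L_□-theory: logical axioms, the axioms of the theory, and the
rules modus ponens, generalization, and necessitation. -/
inductive Provable (T : Set Formula) : Formula → Prop
  | ax {φ : Formula} : φ ∈ T → Provable T φ
  | logic {φ : Formula} : LogicalAxiom φ → Provable T φ
  | mp {φ ψ : Formula} : Provable T (φ.imp ψ) → Provable T φ → Provable T ψ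
  | gen {φ : Formula} (x : ℕ) : Provable T φ → Provable T (Formula.all x φ)
  | nec {φ : Formula} : Provable T φ → Provable T (Formula.box φ)

/-- First-order provability (no necessitation rule); used for the non-modal theory PA. -/
inductive FOProvable (T : Set Formula) : Formula → Prop
  | ax {φ : Formula} : φ ∈ T → FOProvable T φ
  | logic {φ : Formula} : LogicalAxiom φ → FOProvable T φ
  | mp {φ ψ : Formula} : FOProvable T (φ.imp ψ) → FOProvable T φ → FOProvable T ψ
  | gen {φ : Formula} (x : ℕ) : FOProvable T φ → FOProvable T (Formula.all x φ)

/-- Basic (Robinson-style) axioms of arithmetic. -/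
def succNeZero : Formula := (Formula.eq (Term.succ (Term.var 0)) Term.zero).neg
def succInj : Formula :=
  (Formula.eq (Term.succ (Term.var 0)) (Term.succ (Term.var 1))).imp
    (Formula.eq (Term.var 0) (Term.var 1))
def addZero : Formula := Formula.eq (Term.add (Term.var 0) Term.zero) (Term.var 0)
def addSucc : Formula :=
  Formula.eq (Term.add (Term.var 0) (Term.succ (Term.var 1)))
    (Term.succ (Term.add (Term.var 0) (Term.var 1)))
def mulZero : Formula := Formula.eq (Term.mul (Term.var 0) Term.zero) Term.zero
def mulSucc : Formula :=
  Formula.eq (Term.mul (Term.var 0) (Term.succ (Term.var 1)))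
    (Term.add (Term.mul (Term.var 0) (Term.var 1)) (Term.var 0))
def leDef : Formula :=
  (Formula.le (Term.var 0) (Term.var 1)).iff
    (Formula.ex 2 (Formula.eq (Term.add (Term.var 0) (Term.var 2)) (Term.var 1)))

def baseAxioms : Set Formula :=
  {succNeZero, succInj, addZero, addSucc, mulZero, mulSucc, leDef}

/-- The induction axiom for the formula `φ` and the variable `x`. -/
def inductionAx (x : ℕ) (φ : Formula) : Formula :=
  ((φ.subst x Term.zero).and
    (Formula.all x (φ.imp (φ.subst x (Term.succ (Term.var x)))))).imp
      (Formula.all x φ)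

/-- Peano arithmetic PA: basic axioms plus induction for L_A-formulas. -/
def PA : Set Formula :=
  baseAxioms ∪ {χ | ∃ (x : ℕ) (φ : Formula), φ.noBox ∧ χ = inductionAx x φ}

/-- PA_□ : basic axioms plus induction for all L_□-formulas. -/
def PABox : Set Formula :=
  baseAxioms ∪ {χ | ∃ (x : ℕ) (φ : Formula), χ = inductionAx x φ}

/-- The distribution axiom K. -/
def axK (φ ψ : Formula) : Formula :=
  (Formula.box (φ.imp ψ)).imp ((Formula.box φ).imp (Formula.box ψ))

/-- PA(K). -/
def PAK : Set Formula := PABox ∪ {χ | ∃ φ ψ : Formula, χ = axK φ ψ}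

/-- The axiom 4. -/
def ax4 (φ : Formula) : Formula := (Formula.box φ).imp (Formula.box (Formula.box φ))

/-- PA(K4). -/
def PAK4 : Set Formula := PAK ∪ {χ | ∃ φ : Formula, χ = ax4 φ}

/-- The axiom of Triv. -/
def axTriv (φ : Formula) : Formula := (Formula.box φ).iff φ

/-- PA(Triv). -/
def PATriv : Set Formula := PAK ∪ {χ | ∃ φ : Formula, χ = axTriv φ}

/-- PA(Ver). -/
def PAVer : Set Formula := PAK ∪ {Formula.box Formula.falsum}

/-- `T` extends `U`: every axiom of `U` is provable in `T`. -/
def Extends (T U : Set Formula) : Prop := ∀ φ ∈ U, Provable T φ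

/-- Consistency. -/
def Consistent (T : Set Formula) : Prop := ¬ Provable T Formula.falsum

/-- The class Δ₀ of bounded L_A-formulas. -/
inductive IsDelta0 : Formula → Prop
  | falsum : IsDelta0 Formula.falsum
  | eq (t u : Term) : IsDelta0 (Formula.eq t u)
  | le (t u : Term) : IsDelta0 (Formula.le t u)
  | and {φ ψ : Formula} : IsDelta0 φ → IsDelta0 ψ → IsDelta0 (φ.and ψ)
  | or {φ ψ : Formula} : IsDelta0 φ → IsDelta0 ψ → IsDelta0 (φ.or ψ)
  | imp {φ ψ : Formula} : IsDelta0 φ → IsDelta0 ψ → IsDelta0 (φ.imp ψ)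
  | neg {φ : Formula} : IsDelta0 φ → IsDelta0 φ.neg
  | ball {x : ℕ} {t : Term} {φ : Formula} :
      x ∉ t.fv → IsDelta0 φ → IsDelta0 (Formula.ball x t φ)
  | bex {x : ℕ} {t : Term} {φ : Formula} :
      x ∉ t.fv → IsDelta0 φ → IsDelta0 (Formula.bex x t φ)

/-- The class Σ₁ of L_A-formulas. -/
inductive IsSigma1 : Formula → Prop
  | delta0 {φ : Formula} : IsDelta0 φ → IsSigma1 φ
  | and {φ ψ : Formula} : IsSigma1 φ → IsSigma1 ψ → IsSigma1 (φ.and ψ)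
  | or {φ ψ : Formula} : IsSigma1 φ → IsSigma1 ψ → IsSigma1 (φ.or ψ)
  | ex {x : ℕ} {φ : Formula} : IsSigma1 φ → IsSigma1 (Formula.ex x φ)
  | ball {x : ℕ} {t : Term} {φ : Formula} :
      x ∉ t.fv → IsSigma1 φ → IsSigma1 (Formula.ball x t φ)

/-- The class B of boxed formulas. -/
def IsB (φ : Formula) : Prop := ∃ ψ : Formula, φ = Formula.box ψ

/-- The class ΔB. -/
inductive IsDeltaB : Formula → Prop
  | delta0 {φ : Formula} : IsDelta0 φ → IsDeltaB φ
  | b (ψ : Formula) : IsDeltaB (Formula.box ψ)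
  | and {φ ψ : Formula} : IsDeltaB φ → IsDeltaB ψ → IsDeltaB (φ.and ψ)
  | or {φ ψ : Formula} : IsDeltaB φ → IsDeltaB ψ → IsDeltaB (φ.or ψ)
  | ball {x : ℕ} {t : Term} {φ : Formula} :
      x ∉ t.fv → IsDeltaB φ → IsDeltaB (Formula.ball x t φ)
  | bex {x : ℕ} {t : Term} {φ : Formula} :
      x ∉ t.fv → IsDeltaB φ → IsDeltaB (Formula.bex x t φ)

/-- The class ΣB. -/
inductive IsSigmaB : Formula → Prop
  | sigma1 {φ : Formula} : IsSigma1 φ → IsSigmaB φ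
  | b (ψ : Formula) : IsSigmaB (Formula.box ψ)
  | and {φ ψ : Formula} : IsSigmaB φ → IsSigmaB ψ → IsSigmaB (φ.and ψ)
  | or {φ ψ : Formula} : IsSigmaB φ → IsSigmaB ψ → IsSigmaB (φ.or ψ)
  | ex {x : ℕ} {φ : Formula} : IsSigmaB φ → IsSigmaB (Formula.ex x φ)
  | ball {x : ℕ} {t : Term} {φ : Formula} :
      x ∉ t.fv → IsSigmaB φ → IsSigmaB (Formula.ball x t φ)

/-- Iterated disjunction (the empty disjunction is ⊥). -/
def disj : List Formula → Formula
  | [] => Formula.falsum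
  | [φ] => φ
  | φ :: ψ :: l => φ.or (disj (ψ :: l))

/-- Iterated conjunction (the empty conjunction is ⊤). -/
def conj : List Formula → Formula
  | [] => Formula.falsum.neg
  | [φ] => φ
  | φ :: ψ :: l => φ.and (conj (ψ :: l))

/-- Γ-disjunction property. -/
def HasDP (T : Set Formula) (Γ : Formula → Prop) : Prop :=
  ∀ φ ψ : Formula, Γ φ → Γ ψ → Sentence φ → Sentence ψ →
    Provable T (φ.or ψ) → Provable T φ ∨ Provable T ψ

/-- (Γ, Θ)-disjunction property. -/
def HasDP2 (T : Set Formula) (Γ Θ : Formula → Prop) : Prop :=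
  ∀ φ ψ : Formula, Γ φ → Θ ψ → Sentence φ → Sentence ψ →
    Provable T (φ.or ψ) → Provable T φ ∨ Provable T ψ

/-- Γ-existence property. -/
def HasEP (T : Set Formula) (Γ : Formula → Prop) : Prop :=
  ∀ (x : ℕ) (φ : Formula), Γ φ → φ.fv ⊆ {x} →
    Provable T (Formula.ex x φ) → ∃ n : ℕ, Provable T (φ.subst x (Term.numeral n))

/-- Modal disjunction property. -/
def HasMDP (T : Set Formula) : Prop :=
  ∀ φ ψ : Formula, Sentence φ → Sentence ψ →
    Provable T ((Formula.box φ).or (Formula.box ψ)) → Provable T φ ∨ Provable T ψ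

/-- Modal existence property. -/
def HasMEP (T : Set Formula) : Prop :=
  ∀ (x : ℕ) (φ : Formula), φ.fv ⊆ {x} →
    Provable T (Formula.ex x (Formula.box φ)) →
      ∃ n : ℕ, Provable T (φ.subst x (Term.numeral n))

/-- n-fold B-disjunction property. -/
def HasBnDP (T : Set Formula) (n : ℕ) : Prop :=
  ∀ φ : Fin n → Formula, (∀ i, Sentence (φ i)) →
    Provable T (disj (List.ofFn fun i => Formula.box (φ i))) →
    ∃ i, Provable T (Formula.box (φ i))

/-- Σ₁-soundness. -/
def Sigma1Sound (T : Set Formula) : Prop :=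
  ∀ φ : Formula, IsSigma1 φ → Sentence φ → Provable T φ → StdTrue φ

/-- L_A-soundness. -/
def LASound (T : Set Formula) : Prop :=
  ∀ φ : Formula, φ.noBox → Sentence φ → Provable T φ → StdTrue φ

/-- `T` is recursively enumerable (via the Gödel numbering of formulas). -/
def RE (T : Set Formula) : Prop :=
  Nat.Partrec fun n => Part.assert (∃ φ ∈ T, Formula.code φ = n) fun _ => Part.some 0

/-- A fixed natural Σ₁ provability predicate `Pr_T(x)` for the theory `T`:
a Σ₁ L_A-formula with only the free variable `0` which numerates provability in `T`
in the standard model and satisfies the standard derivability conditions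
(provably in PA). -/
structure ProvPred (T : Set Formula) where
  pr : Formula
  noBox : pr.noBox
  sigma1 : IsSigma1 pr
  fvSub : pr.fv ⊆ {0}
  numerates : ∀ φ : Formula,
    StdTrue (pr.subst 0 (Term.numeral φ.code)) ↔ Provable T φ
  d1 : ∀ φ : Formula, Provable T φ → FOProvable PA (pr.subst 0 (Term.numeral φ.code))
  d2 : ∀ φ ψ : Formula,
    FOProvable PA ((pr.subst 0 (Term.numeral (φ.imp ψ).code)).imp
      ((pr.subst 0 (Term.numeral φ.code)).imp (pr.subst 0 (Term.numeral ψ.code))))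
  necClosed : ∀ φ : Formula,
    FOProvable PA ((pr.subst 0 (Term.numeral φ.code)).imp
      (pr.subst 0 (Term.numeral (Formula.box φ).code)))

/-- `Pr_T(⌜φ⌝)`. -/
def ProvPred.app {T : Set Formula} (P : ProvPred T) (φ : Formula) : Formula :=
  P.pr.subst 0 (Term.numeral φ.code)

/-- Γ-disjunctive correctness (Γ-DC). -/
def DC (T : Set Formula) (P : ProvPred T) (Γ : Formula → Prop) : Prop :=
  ∀ φ : Formula, Γ φ → Sentence φ → Provable T (φ.or (P.app φ)) → Provable T φ

/-- The substitution replacing each variable by the numeral of its value. -/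
def numeralSubst (v : ℕ → ℕ) : ℕ → Term := fun x => Term.numeral (v x)

/-- Standard-model satisfaction of the ρ_T-translation: `ρ_T` is the identity on
L_A-formulas, commutes with connectives and quantifiers, and sends `□φ(x⃗)` to
`Pr_T(⌜□φ(ẋ⃗)⌝)`, whose truth in ℕ (for a natural provability predicate) amounts to
provability in `T` of `□φ(n̄⃗)`. -/
def RhoSat (T : Set Formula) : Formula → (ℕ → ℕ) → Prop
  | .falsum, _ => False
  | .eq t u, v => t.val v = u.val v
  | .le t u, v => t.val v ≤ u.val v
  | .and φ ψ, v => RhoSat T φ v ∧ RhoSat T ψ v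
  | .or φ ψ, v => RhoSat T φ v ∨ RhoSat T ψ v
  | .imp φ ψ, v => RhoSat T φ v → RhoSat T ψ v
  | .neg φ, v => ¬ RhoSat T φ v
  | .all x φ, v => ∀ n : ℕ, RhoSat T φ (Function.update v x n)
  | .ex x φ, v => ∃ n : ℕ, RhoSat T φ (Function.update v x n)
  | .box φ, v => Provable T (Formula.box (φ.substAll (numeralSubst v)))

/-- Standard-model satisfaction of the π_T-translation: `π_T` is the identity on
L_A-formulas, commutes with connectives and quantifiers, and sends `□φ(x⃗)` to
`Pr_T(⌜φ(ẋ⃗)⌝)`, whose truth in ℕ (for a natural provability predicate) amounts to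
provability in `T` of `φ(n̄⃗)`. -/
def PiSat (T : Set Formula) : Formula → (ℕ → ℕ) → Prop
  | .falsum, _ => False
  | .eq t u, v => t.val v = u.val v
  | .le t u, v => t.val v ≤ u.val v
  | .and φ ψ, v => PiSat T φ v ∧ PiSat T ψ v
  | .or φ ψ, v => PiSat T φ v ∨ PiSat T ψ v
  | .imp φ ψ, v => PiSat T φ v → PiSat T ψ v
  | .neg φ, v => ¬ PiSat T φ v
  | .all x φ, v => ∀ n : ℕ, PiSat T φ (Function.update v x n)
  | .ex x φ, v => ∃ n : ℕ, PiSat T φ (Function.update v x n)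
  | .box φ, v => Provable T (φ.substAll (numeralSubst v))

/-- Weak ΣB-soundness: every provable ΣB sentence is true in ℕ under ρ_T. -/
def WeaklySigmaBSound (T : Set Formula) : Prop :=
  ∀ φ : Formula, IsSigmaB φ → Sentence φ → Provable T φ → RhoSat T φ fun _ => 0

/-- ΣB-soundness: every provable ΣB sentence is true in ℕ under π_T. -/
def SigmaBSound (T : Set Formula) : Prop :=
  ∀ φ : Formula, IsSigmaB φ → Sentence φ → Provable T φ → PiSat T φ fun _ => 0

end ModalArith
namespace ModalArith

/-! ### Propositional completeness: derivations and maximal consistent sets -/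

inductive Ded (T S : Set Formula) : Formula → Prop
  | prov {φ : Formula} : Provable T φ → Ded T S φ
  | hyp {φ : Formula} : φ ∈ S → Ded T S φ
  | mp {φ ψ : Formula} : Ded T S (φ.imp ψ) → Ded T S φ → Ded T S ψ

theorem Ded.ofLogic {T S : Set Formula} {φ : Formula} (h : LogicalAxiom φ) : Ded T S φ :=
  .prov (.logic h)

theorem Ded.impSelf {T S : Set Formula} (φ : Formula) : Ded T S (φ.imp φ) :=
  .mp (.mp (.ofLogic (.imp2 φ (φ.imp φ) φ)) (.ofLogic (.imp1 _ _))) (.ofLogic (.imp1 _ _))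

theorem Ded.ded {T S : Set Formula} {φ ψ : Formula} (h : Ded T (insert φ S) ψ) :
    Ded T S (φ.imp ψ) := by
  induction h with
  | prov h => exact .mp (.ofLogic (.imp1 _ _)) (.prov h)
  | hyp h =>
    rcases h with rfl | h
    · exact Ded.impSelf _
    · exact .mp (.ofLogic (.imp1 _ _)) (.hyp h)
  | mp _ _ ih1 ih2 => exact .mp (.mp (.ofLogic (.imp2 _ _ _)) ih1) ih2

theorem Ded.mono {T S S' : Set Formula} (hs : S ⊆ S') {φ : Formula} (h : Ded T S φ) :
    Ded T S' φ := by
  induction h with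
  | prov h => exact .prov h
  | hyp h => exact .hyp (hs h)
  | mp _ _ ih1 ih2 => exact .mp ih1 ih2

theorem Ded.toProv {T : Set Formula} {φ : Formula} (h : Ded T ∅ φ) : Provable T φ := by
  induction h with
  | prov h => exact h
  | hyp h => exact h.elim
  | mp _ _ ih1 ih2 => exact .mp ih1 ih2

theorem Ded.chain {T : Set Formula} {c : Set (Set Formula)} (hc : IsChain (· ⊆ ·) c)
    (hne : c.Nonempty) {φ : Formula} (h : Ded T (⋃₀ c) φ) : ∃ S ∈ c, Ded T S φ := by
  induction h with
  | prov h => obtain ⟨S, hS⟩ := hne; exact ⟨S, hS, .prov h⟩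
  | hyp h => obtain ⟨S, hS, h⟩ := h; exact ⟨S, hS, .hyp h⟩
  | mp _ _ ih1 ih2 =>
    obtain ⟨S, hS, h1⟩ := ih1
    obtain ⟨S', hS', h2⟩ := ih2
    rcases hc.total hS hS' with h | h
    · exact ⟨S', hS', .mp (h1.mono h) h2⟩
    · exact ⟨S, hS, .mp h1 (h2.mono h)⟩

structure MCS (T : Set Formula) (M : Formula → Prop) : Prop where
  prov : ∀ {φ}, Provable T φ → M φ
  imp : ∀ φ ψ, M (φ.imp ψ) ↔ (M φ → M ψ)
  neg : ∀ φ, M φ.neg ↔ ¬ M φ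
  and : ∀ φ ψ, M (φ.and ψ) ↔ (M φ ∧ M ψ)
  or : ∀ φ ψ, M (φ.or ψ) ↔ (M φ ∨ M ψ)
  falsum : ¬ M Formula.falsum

theorem complete {T : Set Formula} {φ : Formula} (h : ∀ M, MCS T M → M φ) : Provable T φ := by
  by_contra hn
  have h0 : (∅ : Set Formula) ∈ {S | ¬ Ded T S φ} := fun h => hn h.toProv
  obtain ⟨S, -, hS⟩ := zorn_subset_nonempty {S | ¬ Ded T S φ} (by
    intro c hc hch hne
    refine ⟨⋃₀ c, ?_, fun s hs => Set.subset_sUnion_of_mem hs⟩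
    intro hd
    obtain ⟨S, hS, hd⟩ := hd.chain hch hne
    exact hc hS hd) ∅ h0
  have hnφ : ¬ Ded T S φ := hS.prop
  have key : ∀ ψ, ¬ Ded T S ψ → Ded T S (ψ.imp φ) := by
    intro ψ hψ
    apply Ded.ded
    by_contra hc
    have := hS.le_of_ge (y := insert ψ S) hc (Set.subset_insert _ _)
    exact hψ (.hyp (this (Set.mem_insert _ _)))
  have hneg : ∀ ψ, Ded T S ψ.neg ↔ ¬ Ded T S ψ := by
    intro ψ
    constructor
    · intro h1 h2
      exact hnφ (.mp (.mp (.ofLogic (.negE _ _)) h1) h2)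
    · intro h1
      by_contra h2
      have k1 := key _ h1
      have k2 := key _ h2
      have k3 : Ded T S (φ.neg.imp φ) := by
        apply Ded.ded
        have hs : S ⊆ insert φ.neg S := Set.subset_insert _ _
        have a : Ded T (insert φ.neg S) φ.neg := .hyp (Set.mem_insert _ _)
        exact .mp (k2.mono hs) (.mp (.mp (.ofLogic (.negI _ _)) (k1.mono hs))
          (.mp (.ofLogic (.imp1 _ _)) a))
      exact hnφ (.mp (.ofLogic (.dne _))
        (.mp (.mp (.ofLogic (.negI _ _)) k3) (Ded.impSelf _)))
  refine hnφ (h (Ded T S) ⟨fun h => .prov h, ?_, hneg, ?_, ?_, ?_⟩)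
  · intro α β
    refine ⟨fun h1 h2 => .mp h1 h2, fun h1 => ?_⟩
    by_cases hα : Ded T S α
    · exact .mp (.ofLogic (.imp1 _ _)) (h1 hα)
    · exact .mp (.ofLogic (.negE _ _)) ((hneg α).2 hα)
  · intro α β
    exact ⟨fun h1 => ⟨.mp (.ofLogic (.andE1 _ _)) h1, .mp (.ofLogic (.andE2 _ _)) h1⟩,
      fun h1 => .mp (.mp (.ofLogic (.andI _ _)) h1.1) h1.2⟩
  · intro α β
    constructor
    · intro h1
      by_contra hc
      push Not at hc
      exact hnφ (.mp (.mp (.mp (.ofLogic (.orE _ _ _)) (key _ hc.1)) (key _ hc.2)) h1)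
    · rintro (h1 | h1)
      · exact .mp (.ofLogic (.orI1 _ _)) h1
      · exact .mp (.ofLogic (.orI2 _ _)) h1
  · intro h1
    exact hnφ (.mp (.ofLogic (.falsumE _)) h1)

/-! ### Syntactic lemmas -/

namespace Term

theorem substAll_congr {t : Term} {v w : ℕ → Term} (h : ∀ x ∈ t.fv, v x = w x) :
    t.substAll v = t.substAll w := by
  induction t <;> simp_all [substAll, fv]

theorem substAll_var (t : Term) : t.substAll Term.var = t := by
  induction t <;> simp_all [substAll]

theorem substAll_self {t : Term} {v : ℕ → Term} (h : ∀ x ∈ t.fv, v x = var x) :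
    t.substAll v = t :=
  (substAll_congr h).trans (substAll_var t)

theorem substAll_comp (t : Term) (v w : ℕ → Term) :
    (t.substAll v).substAll w = t.substAll (fun x => (v x).substAll w) := by
  induction t <;> simp_all [substAll]

theorem fv_substAll {t : Term} {v : ℕ → Term} {z : ℕ} (h : z ∈ (t.substAll v).fv) :
    ∃ w ∈ t.fv, z ∈ (v w).fv := by
  induction t with
  | var x => simpa [fv, substAll] using h
  | zero => simp [substAll, fv] at h
  | succ t ih => exact ih h
  | add t u ih1 ih2 =>
    simp only [substAll, fv, Finset.mem_union] at h ⊢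
    rcases h with h | h
    · obtain ⟨w, a, b⟩ := ih1 h; exact ⟨w, .inl a, b⟩
    · obtain ⟨w, a, b⟩ := ih2 h; exact ⟨w, .inr a, b⟩
  | mul t u ih1 ih2 =>
    simp only [substAll, fv, Finset.mem_union] at h ⊢
    rcases h with h | h
    · obtain ⟨w, a, b⟩ := ih1 h; exact ⟨w, .inl a, b⟩
    · obtain ⟨w, a, b⟩ := ih2 h; exact ⟨w, .inr a, b⟩

end Term

namespace Formula

theorem substAll_congr {φ : Formula} : ∀ {v w : ℕ → Term}, (∀ x ∈ φ.fv, v x = w x) →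
    φ.substAll v = φ.substAll w := by
  induction φ with
  | falsum => intros; rfl
  | eq t u =>
    intro v w h
    simp only [fv, Finset.mem_union] at h
    simp only [substAll]
    rw [Term.substAll_congr (t := t) fun x hx => h x (.inl hx),
      Term.substAll_congr (t := u) fun x hx => h x (.inr hx)]
  | le t u =>
    intro v w h
    simp only [fv, Finset.mem_union] at h
    simp only [substAll]
    rw [Term.substAll_congr (t := t) fun x hx => h x (.inl hx),
      Term.substAll_congr (t := u) fun x hx => h x (.inr hx)]
  | and φ ψ ih1 ih2 | or φ ψ ih1 ih2 | imp φ ψ ih1 ih2 =>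
    intro v w h
    simp only [fv, Finset.mem_union] at h
    simp only [substAll]
    rw [ih1 fun x hx => h x (.inl hx), ih2 fun x hx => h x (.inr hx)]
  | neg φ ih | box φ ih =>
    intro v w h
    simp only [substAll]
    rw [ih h]
  | all y φ ih | ex y φ ih =>
    intro v w h
    simp only [substAll]
    rw [ih]
    intro x hx
    by_cases hxy : x = y
    · subst hxy; simp
    · simp only [Function.update_of_ne hxy]
      exact h x (Finset.mem_erase.2 ⟨hxy, hx⟩)

theorem substAll_var (φ : Formula) : φ.substAll Term.var = φ := by
  induction φ <;> simp_all [substAll, Term.substAll_var]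

theorem substAll_self {φ : Formula} {v : ℕ → Term} (h : ∀ x ∈ φ.fv, v x = Term.var x) :
    φ.substAll v = φ :=
  (substAll_congr h).trans (substAll_var φ)

theorem subst_of_not_fv {φ : Formula} {x : ℕ} {t : Term} (h : x ∉ φ.fv) : φ.subst x t = φ := by
  apply substAll_self
  intro y hy
  rw [Function.update_of_ne]
  rintro rfl
  exact h hy

theorem subst_var (φ : Formula) (x : ℕ) : φ.subst x (Term.var x) = φ := by
  simp [subst, substAll_var]

theorem fv_substAll {φ : Formula} : ∀ {v : ℕ → Term} {z : ℕ}, z ∈ (φ.substAll v).fv →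
    ∃ w ∈ φ.fv, z ∈ (v w).fv := by
  induction φ with
  | falsum => intro v z h; simp [substAll, fv] at h
  | eq t u | le t u =>
    intro v z h
    simp only [substAll, fv, Finset.mem_union] at h ⊢
    rcases h with h | h
    · obtain ⟨w, a, b⟩ := Term.fv_substAll h; exact ⟨w, .inl a, b⟩
    · obtain ⟨w, a, b⟩ := Term.fv_substAll h; exact ⟨w, .inr a, b⟩
  | and φ ψ ih1 ih2 | or φ ψ ih1 ih2 | imp φ ψ ih1 ih2 =>
    intro v z h
    simp only [substAll, fv, Finset.mem_union] at h ⊢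
    rcases h with h | h
    · obtain ⟨w, a, b⟩ := ih1 h; exact ⟨w, .inl a, b⟩
    · obtain ⟨w, a, b⟩ := ih2 h; exact ⟨w, .inr a, b⟩
  | neg φ ih | box φ ih => intro v z h; exact ih h
  | all y φ ih | ex y φ ih =>
    intro v z h
    simp only [substAll, fv, Finset.mem_erase] at h ⊢
    obtain ⟨w, a, b⟩ := ih h.2
    by_cases hw : w = y
    · subst hw
      simp [Term.fv] at b
      exact absurd b h.1
    · rw [Function.update_of_ne hw] at b
      exact ⟨w, ⟨hw, a⟩, b⟩

theorem not_fv_subst {φ : Formula} {x : ℕ} {s : Term} (h : x ∉ s.fv) : x ∉ (φ.subst x s).fv := by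
  intro hc
  obtain ⟨w, -, hw⟩ := fv_substAll hc
  by_cases hx : w = x
  · subst hx; simp at hw; exact h hw
  · rw [Function.update_of_ne hx] at hw
    simp [Term.fv] at hw
    exact hx hw.symm

theorem freeFor_of_not_fv {φ : Formula} {x : ℕ} {s : Term} (h : x ∉ φ.fv) : φ.freeFor s x := by
  induction φ with
  | falsum | eq t u | le t u => trivial
  | and φ ψ ih1 ih2 | or φ ψ ih1 ih2 | imp φ ψ ih1 ih2 =>
    simp only [fv, Finset.mem_union, not_or] at h
    exact ⟨ih1 h.1, ih2 h.2⟩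
  | neg φ ih | box φ ih => exact ih h
  | all y φ ih | ex y φ ih =>
    simp only [fv, Finset.mem_erase, not_and] at h
    by_cases hy : x = y
    · exact .inl hy
    · exact .inr (.inl (h hy))

/-- terms whose variables are contained in `{x}` are free for `x` -/
theorem freeFor_of_fv_sub {φ : Formula} {x : ℕ} {s : Term} (h : ∀ y ∈ s.fv, y = x) :
    φ.freeFor s x := by
  induction φ with
  | falsum | eq t u | le t u => trivial
  | and φ ψ ih1 ih2 | or φ ψ ih1 ih2 | imp φ ψ ih1 ih2 => exact ⟨ih1, ih2⟩
  | neg φ ih | box φ ih => exact ih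
  | all y φ ih | ex y φ ih =>
    by_cases hy : x = y
    · exact .inl hy
    · exact .inr (.inr ⟨fun hc => hy (h y hc).symm, ih⟩)

theorem exists_fresh (φ : Formula) (x : ℕ) :
    ∃ N, ∀ y, N ≤ y → y ∉ φ.fv ∧ φ.freeFor (Term.var y) x := by
  have hfv : ∃ N, ∀ y, N ≤ y → y ∉ φ.fv :=
    ⟨φ.fv.sup id + 1, fun y hy hc => by
      have := Finset.le_sup (f := id) hc
      simp only [id] at this
      omega⟩
  have hff : ∃ N, ∀ y, N ≤ y → φ.freeFor (Term.var y) x := by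
    clear hfv
    induction φ with
    | falsum | eq t u | le t u => exact ⟨0, fun _ _ => trivial⟩
    | and φ ψ ih1 ih2 | or φ ψ ih1 ih2 | imp φ ψ ih1 ih2 =>
      obtain ⟨N, h1⟩ := ih1
      obtain ⟨N', h2⟩ := ih2
      exact ⟨max N N', fun y hy => ⟨h1 y (by omega), h2 y (by omega)⟩⟩
    | neg φ ih | box φ ih => exact ih
    | all z φ ih | ex z φ ih =>
      obtain ⟨N, h1⟩ := ih
      refine ⟨max N (z + 1), fun y hy => .inr (.inr ⟨?_, h1 y (by omega)⟩)⟩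
      simp only [Term.fv, Finset.mem_singleton]
      omega
  obtain ⟨N, h1⟩ := hfv
  obtain ⟨N', h2⟩ := hff
  exact ⟨max N N', fun y hy => ⟨h1 y (by omega), h2 y (by omega)⟩⟩

/-- quantifier-free formulas (boxes allowed) -/
def qf : Formula → Prop
  | falsum => True
  | eq _ _ => True
  | le _ _ => True
  | and φ ψ => qf φ ∧ qf ψ
  | or φ ψ => qf φ ∧ qf ψ
  | imp φ ψ => qf φ ∧ qf ψ
  | neg φ => qf φ
  | all _ _ => False
  | ex _ _ => False
  | box φ => qf φ

theorem qf.freeFor {φ : Formula} (h : φ.qf) (s : Term) (x : ℕ) : φ.freeFor s x := by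
  induction φ <;> simp_all [qf, Formula.freeFor]

theorem qf.substAll {φ : Formula} (h : φ.qf) (v : ℕ → Term) : (φ.substAll v).qf := by
  induction φ <;> simp_all [qf, Formula.substAll]

theorem qf.comp {φ : Formula} (h : φ.qf) (v w : ℕ → Term) :
    (φ.substAll v).substAll w = φ.substAll (fun x => (v x).substAll w) := by
  induction φ <;> simp_all [qf, Formula.substAll, Term.substAll_comp]

end Formula

/-! ### Derived first-order rules -/

theorem Provable.inst {T : Set Formula} {φ : Formula} (h : Provable T φ) (x : ℕ) (t : Term)
    (hf : φ.freeFor t x) : Provable T (φ.subst x t) :=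
  .mp (.logic (.allE x t φ hf)) (.gen x h)

theorem Provable.genImp {T : Set Formula} {γ ψ : Formula} {x : ℕ} (hx : x ∉ γ.fv)
    (h : Provable T (γ.imp ψ)) : Provable T (γ.imp (.all x ψ)) :=
  .mp (.logic (.allImp x γ ψ hx)) (.gen x h)

theorem Provable.exImp {T : Set Formula} {φ ψ : Formula} {x : ℕ} (hx : x ∉ ψ.fv)
    (h : Provable T (φ.imp ψ)) : Provable T ((Formula.ex x φ).imp ψ) :=
  .mp (.logic (.exE x φ ψ hx)) (.gen x h)

theorem allSelf {T : Set Formula} (x : ℕ) (φ : Formula) :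
    Provable T ((Formula.all x φ).imp φ) := by
  have := LogicalAxiom.allE x (Term.var x) φ (Formula.freeFor_of_fv_sub (by simp [Term.fv]))
  rw [Formula.subst_var] at this
  exact .logic this

theorem exSelf {T : Set Formula} (x : ℕ) (φ : Formula) :
    Provable T (φ.imp (Formula.ex x φ)) := by
  have := LogicalAxiom.exI x (Term.var x) φ (Formula.freeFor_of_fv_sub (by simp [Term.fv]))
  rw [Formula.subst_var] at this
  exact .logic this

/-- substitution for three variables -/
def sub3 (t u w : Term) : ℕ → Term
  | 0 => t
  | 1 => u
  | 2 => w
  | n => Term.var n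

theorem Provable.inst3 {T : Set Formula} {φ : Formula} (h : Provable T φ) (hq : φ.qf)
    (t u w : Term) : Provable T (φ.substAll (sub3 t u w)) := by
  obtain ⟨N, hN3, hNφ, hNt, hNu⟩ : ∃ N, 3 ≤ N ∧ (∀ y ∈ φ.fv, y < N) ∧
      (∀ y ∈ t.fv, y < N) ∧ (∀ y ∈ u.fv, y < N) := by
    refine ⟨φ.fv.sup id + t.fv.sup id + u.fv.sup id + 3, by omega, ?_, ?_, ?_⟩ <;>
    · intro y hy
      have := Finset.le_sup (f := id) hy
      simp only [id] at this
      omega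
  have q1 := hq.substAll (Function.update Term.var 1 (Term.var N))
  have q2 := q1.substAll (Function.update Term.var 2 (Term.var (N + 1)))
  have q3 := q2.substAll (Function.update Term.var 0 t)
  have q4 := q3.substAll (Function.update Term.var N u)
  have h1 := h.inst 1 (Term.var N) (hq.freeFor _ _)
  have h2 := h1.inst 2 (Term.var (N + 1)) (q1.freeFor _ _)
  have h3 := h2.inst 0 t (q2.freeFor _ _)
  have h4 := h3.inst N u (q3.freeFor _ _)
  have h5 := h4.inst (N + 1) w (q4.freeFor _ _)
  simp only [Formula.subst] at h5
  rw [q3.comp, q2.comp, q1.comp, hq.comp] at h5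
  convert h5 using 1
  apply Formula.substAll_congr
  intro x hx
  have hxN := hNφ x hx
  have ht : ∀ v : ℕ → Term, (∀ y < N, v y = Term.var y) → t.substAll v = t := fun v hv =>
    Term.substAll_self fun y hy => hv y (hNt y hy)
  have hu : ∀ v : ℕ → Term, (∀ y < N, v y = Term.var y) → u.substAll v = u := fun v hv =>
    Term.substAll_self fun y hy => hv y (hNu y hy)
  have hlt : ∀ y < N, y ≠ N := fun y hy => by omega
  have hlt' : ∀ y < N, y ≠ N + 1 := fun y hy => by omega
  by_cases h0 : x = 0
  · subst h0
    simp [sub3, Term.substAll]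
    symm
    apply ht
    intro y hy
    simp [Function.update_of_ne (hlt y hy), Function.update_of_ne (hlt' y hy), Term.substAll]
  by_cases h1 : x = 1
  · subst h1
    have a1 : N ≠ 2 := by omega
    have a2 : N ≠ 0 := by omega
    simp [sub3, Term.substAll, Function.update_of_ne a1, Function.update_of_ne a2]
    symm
    apply hu
    intro y hy
    exact Function.update_of_ne (hlt' y hy) _ _
  by_cases h2 : x = 2
  · subst h2
    simp [sub3, Term.substAll]
  have : sub3 t u w x = Term.var x := by
    rcases x with _ | _ | _ | x <;> simp_all [sub3]
  rw [this]
  simp [Function.update_of_ne, h0, h1, h2, hlt x hxN, hlt' x hxN, Term.substAll]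

end ModalArith
namespace ModalArith

open Formula Term

section
variable {T : Set Formula}

theorem baseProv (hT : Extends T PAK4) {φ : Formula} (h : φ ∈ baseAxioms) : Provable T φ :=
  hT φ (.inl (.inl (.inl h)))

theorem indProv (hT : Extends T PAK4) (x : ℕ) (φ : Formula) : Provable T (inductionAx x φ) :=
  hT _ (.inl (.inl (.inr ⟨x, φ, rfl⟩)))

theorem kProv (hT : Extends T PAK4) (φ ψ : Formula) : Provable T (axK φ ψ) :=
  hT _ (.inl (.inr ⟨φ, ψ, rfl⟩))

theorem fourProv (hT : Extends T PAK4) (φ : Formula) :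
    Provable T ((Formula.box φ).imp (Formula.box (Formula.box φ))) :=
  hT _ (.inr ⟨φ, rfl⟩)

theorem indRule (hT : Extends T PAK4) (x : ℕ) (φ : Formula)
    (h0 : Provable T (φ.subst x Term.zero))
    (h1 : Provable T (φ.imp (φ.subst x (Term.succ (Term.var x))))) : Provable T φ :=
  .mp (allSelf x φ) (.mp (indProv hT x φ) (.mp (.mp (.logic (.andI _ _)) h0) (.gen x h1)))

theorem casesRule (hT : Extends T PAK4) (x : ℕ) (φ : Formula)
    (h0 : Provable T (φ.subst x Term.zero))
    (h1 : Provable T (φ.subst x (Term.succ (Term.var x)))) : Provable T φ :=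
  indRule hT x φ h0 (.mp (.logic (.imp1 _ _)) h1)

theorem bmono (hT : Extends T PAK4) {φ ψ : Formula} (h : Provable T (φ.imp ψ)) :
    Provable T ((Formula.box φ).imp (Formula.box ψ)) :=
  .mp (kProv hT φ ψ) (.nec h)

theorem bmono2 (hT : Extends T PAK4) {φ ψ χ : Formula} (h : Provable T (φ.imp (ψ.imp χ))) :
    Provable T ((Formula.box φ).imp ((Formula.box ψ).imp (Formula.box χ))) := by
  apply complete
  intro M hM
  have h1 := hM.prov (bmono hT h)
  have h2 := hM.prov (kProv hT ψ χ)
  simp only [axK, hM.imp] at *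
  tauto

/-! Basic arithmetic -/

theorem pSuccNeZero (hT : Extends T PAK4) (t : Term) :
    Provable T (Formula.eq t.succ .zero).neg := by
  simpa [Formula.substAll, Term.substAll, sub3, succNeZero] using
    (baseProv hT (φ := succNeZero) (by simp [baseAxioms])).inst3 (by simp [qf, succNeZero]) t t t

theorem pSuccInj (hT : Extends T PAK4) (t u : Term) :
    Provable T ((Formula.eq t.succ u.succ).imp (Formula.eq t u)) := by
  simpa [Formula.substAll, Term.substAll, sub3, succInj] using
    (baseProv hT (φ := succInj) (by simp [baseAxioms])).inst3 (by simp [qf, succInj]) t u t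

theorem pAddZero (hT : Extends T PAK4) (t : Term) :
    Provable T (Formula.eq (t.add .zero) t) := by
  simpa [Formula.substAll, Term.substAll, sub3, addZero] using
    (baseProv hT (φ := addZero) (by simp [baseAxioms])).inst3 (by simp [qf, addZero]) t t t

theorem pAddSucc (hT : Extends T PAK4) (t u : Term) :
    Provable T (Formula.eq (t.add u.succ) (t.add u).succ) := by
  simpa [Formula.substAll, Term.substAll, sub3, addSucc] using
    (baseProv hT (φ := addSucc) (by simp [baseAxioms])).inst3 (by simp [qf, addSucc]) t u t

theorem MCS.refl {M : Formula → Prop} (hM : MCS T M) (t : Term) : M (.eq t t) :=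
  hM.prov (.logic (.eqRefl t))

theorem MCS.symm {M : Formula → Prop} (hM : MCS T M) {t u : Term} (h : M (.eq t u)) :
    M (.eq u t) :=
  (hM.imp _ _).1 (hM.prov (.logic (.eqSymm t u))) h

theorem MCS.trans {M : Formula → Prop} (hM : MCS T M) {t u w : Term} (h : M (.eq t u))
    (h' : M (.eq u w)) : M (.eq t w) :=
  (hM.imp _ _).1 ((hM.imp _ _).1 (hM.prov (.logic (.eqTrans t u w))) h) h'

theorem MCS.succ {M : Formula → Prop} (hM : MCS T M) {t u : Term} (h : M (.eq t u)) :
    M (.eq t.succ u.succ) :=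
  (hM.imp _ _).1 (hM.prov (.logic (.eqSucc t u))) h

theorem MCS.add {M : Formula → Prop} (hM : MCS T M) {t u t' u' : Term} (h : M (.eq t u))
    (h' : M (.eq t' u')) : M (.eq (t.add t') (u.add u')) :=
  (hM.imp _ _).1 ((hM.imp _ _).1 (hM.prov (.logic (.eqAdd t u t' u'))) h) h'

theorem MCS.le {M : Formula → Prop} (hM : MCS T M) {t u t' u' : Term} (h : M (.eq t u))
    (h' : M (.eq t' u')) (hl : M (.le t t')) : M (.le u u') :=
  (hM.imp _ _).1 ((hM.imp _ _).1 ((hM.imp _ _).1 (hM.prov (.logic (.eqLe t u t' u'))) h) h') hl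

theorem MCS.succNe (hT : Extends T PAK4) {M : Formula → Prop} (hM : MCS T M) {t : Term} :
    ¬ M (.eq t.succ .zero) :=
  (hM.neg _).1 (hM.prov (pSuccNeZero hT t))

theorem MCS.succInj (hT : Extends T PAK4) {M : Formula → Prop} (hM : MCS T M) {t u : Term}
    (h : M (.eq t.succ u.succ)) : M (.eq t u) :=
  (hM.imp _ _).1 (hM.prov (pSuccInj hT t u)) h

theorem MCS.addZero (hT : Extends T PAK4) {M : Formula → Prop} (hM : MCS T M) (t : Term) :
    M (.eq (t.add .zero) t) := hM.prov (pAddZero hT t)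

theorem MCS.addSucc (hT : Extends T PAK4) {M : Formula → Prop} (hM : MCS T M) (t u : Term) :
    M (.eq (t.add u.succ) (t.add u).succ) := hM.prov (pAddSucc hT t u)

theorem pZeroAdd (hT : Extends T PAK4) (t : Term) :
    Provable T (Formula.eq (Term.zero.add t) t) := by
  have h : Provable T (Formula.eq (Term.zero.add (var 0)) (var 0)) := by
    apply indRule hT 0
    · simpa [Formula.subst, Formula.substAll, Term.substAll] using pAddZero hT .zero
    · apply complete
      intro M hM
      simp [Formula.subst, Formula.substAll, Term.substAll, hM.imp]
      intro h
      exact hM.trans (hM.addSucc hT _ _) (hM.succ h)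
  simpa [Formula.substAll, Term.substAll, sub3] using h.inst3 (by simp [qf]) t t t

theorem pSuccAdd (hT : Extends T PAK4) (t u : Term) :
    Provable T (Formula.eq (t.succ.add u) (t.add u).succ) := by
  have h : Provable T (Formula.eq ((var 0).succ.add (var 1)) ((var 0).add (var 1)).succ) := by
    apply indRule hT 1
    · apply complete
      intro M hM
      simp [Formula.subst, Formula.substAll, Term.substAll]
      exact hM.trans (hM.addZero hT _) (hM.symm (hM.succ (hM.addZero hT _)))
    · apply complete
      intro M hM
      simp [Formula.subst, Formula.substAll, Term.substAll, hM.imp]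
      intro h
      exact hM.trans (hM.addSucc hT _ _)
        (hM.trans (hM.succ h) (hM.symm (hM.succ (hM.addSucc hT _ _))))
  simpa [Formula.substAll, Term.substAll, sub3] using h.inst3 (by simp [qf]) t u t

theorem pLeDef (hT : Extends T PAK4) : Provable T leDef :=
  baseProv hT (φ := leDef) (by simp [baseAxioms])

theorem pLeI (hT : Extends T PAK4) (t u w : Term) :
    Provable T ((Formula.eq (t.add w) u).imp (Formula.le t u)) := by
  have h : Provable T ((Formula.eq ((var 0).add (var 2)) (var 1)).imp
      (Formula.le (var 0) (var 1))) := by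
    apply complete
    intro M hM
    have h1 := hM.prov (pLeDef hT)
    have h2 := hM.prov (exSelf (T := T) 2 (Formula.eq ((var 0).add (var 2)) (var 1)))
    simp only [leDef, Formula.iff, hM.imp, hM.and] at *
    tauto
  simpa [Formula.substAll, Term.substAll, sub3] using h.inst3 (by simp [qf]) t u w

/-- elimination of `≤`, for terms in the variables 0, 1. -/
theorem pLeE (hT : Extends T PAK4) {t u : Term} (ht : t.fv ⊆ {0}) (hu : u.fv ⊆ {1})
    {χ : Formula} (hχ : 2 ∉ χ.fv)
    (h : Provable T ((Formula.eq (t.add (var 2)) u).imp χ)) :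
    Provable T ((Formula.le t u).imp χ) := by
  have h2t : 2 ∉ t.fv := fun hc => by simpa using ht hc
  have h2u : 2 ∉ u.fv := fun hc => by simpa using hu hc
  have h1t : 1 ∉ t.fv := fun hc => by simpa using ht hc
  have h1 := (pLeDef hT).inst 0 t (by simp [leDef, Formula.iff, freeFor, h2t])
  have h2 := h1.inst 1 u (by
    simp [leDef, Formula.iff, freeFor, h2u, Formula.subst, Formula.substAll])
  have e1 : t.substAll (Function.update Term.var 1 u) = t :=
    Term.substAll_self fun x hx => by
      have a : x ≠ 1 := fun hc => h1t (hc ▸ hx)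
      rw [Function.update_of_ne a]
  have e2 : t.substAll (Function.update (Function.update Term.var 1 u) 2 (var 2)) = t :=
    Term.substAll_self fun x hx => by
      have a : x ≠ 1 := fun hc => h1t (hc ▸ hx)
      have b : x ≠ 2 := fun hc => h2t (hc ▸ hx)
      rw [Function.update_of_ne b, Function.update_of_ne a]
  simp [leDef, Formula.iff, Formula.subst, Formula.substAll, Term.substAll, e1, e2] at h2
  have h3 := Provable.exImp hχ h
  apply complete
  intro M hM
  have h2 := hM.prov h2
  have h3 := hM.prov h3
  simp only [hM.imp, hM.and] at *
  tauto

theorem pZeroLe (hT : Extends T PAK4) (t : Term) : Provable T (Formula.le .zero t) :=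
  .mp (pLeI hT .zero t t) (pZeroAdd hT t)

theorem pLeRefl (hT : Extends T PAK4) (t : Term) : Provable T (Formula.le t t) :=
  .mp (pLeI hT t t .zero) (pAddZero hT t)

theorem pNotSuccLeZero (hT : Extends T PAK4) (t : Term) :
    Provable T (Formula.le t.succ .zero).neg := by
  have h : Provable T ((Formula.le (var 0).succ .zero).imp .falsum) := by
    apply pLeE hT (by simp [Term.fv]) (by simp [Term.fv]) (by simp [Formula.fv])
    apply complete
    intro M hM
    simp only [hM.imp]
    intro h
    exact (hM.succNe hT (hM.trans (hM.symm (hM.prov (pSuccAdd hT _ _))) h)).elim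
  have h2 := h.inst3 (by simp [qf]) t t t
  simp [Formula.substAll, Term.substAll, sub3] at h2
  exact .mp (.logic (.negIntro _)) h2

theorem pLeOfSucc (hT : Extends T PAK4) (t u : Term) :
    Provable T ((Formula.le t.succ u.succ).imp (Formula.le t u)) := by
  have h : Provable T ((Formula.le (var 0).succ (var 1).succ).imp (Formula.le (var 0) (var 1))) := by
    apply pLeE hT (by simp [Term.fv]) (by simp [Term.fv]) (by simp [Formula.fv, Term.fv])
    apply complete
    intro M hM
    simp only [hM.imp]
    intro h
    have := hM.succInj hT (hM.trans (hM.symm (hM.prov (pSuccAdd hT _ _))) h)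
    exact (hM.imp _ _).1 (hM.prov (pLeI hT _ _ _)) this
  simpa [Formula.substAll, Term.substAll, sub3] using h.inst3 (by simp [qf]) t u t

theorem pSuccLeSucc (hT : Extends T PAK4) (t u : Term) :
    Provable T ((Formula.le t u).imp (Formula.le t.succ u.succ)) := by
  have h : Provable T ((Formula.le (var 0) (var 1)).imp (Formula.le (var 0).succ (var 1).succ)) := by
    apply pLeE hT (by simp [Term.fv]) (by simp [Term.fv]) (by simp [Formula.fv, Term.fv])
    apply complete
    intro M hM
    simp only [hM.imp]
    intro h
    exact (hM.imp _ _).1 (hM.prov (pLeI hT _ _ (var 2)))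
      (hM.trans (hM.prov (pSuccAdd hT _ _)) (hM.succ h))
  simpa [Formula.substAll, Term.substAll, sub3] using h.inst3 (by simp [qf]) t u t

theorem pLeSucc (hT : Extends T PAK4) (t u : Term) :
    Provable T ((Formula.le t u).imp (Formula.le t u.succ)) := by
  have h : Provable T ((Formula.le (var 0) (var 1)).imp (Formula.le (var 0) (var 1).succ)) := by
    apply pLeE hT (by simp [Term.fv]) (by simp [Term.fv]) (by simp [Formula.fv, Term.fv])
    apply complete
    intro M hM
    simp only [hM.imp]
    intro h
    exact (hM.imp _ _).1 (hM.prov (pLeI hT _ _ (var 2).succ))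
      (hM.trans (hM.addSucc hT _ _) (hM.succ h))
  simpa [Formula.substAll, Term.substAll, sub3] using h.inst3 (by simp [qf]) t u t

theorem pLeCases (hT : Extends T PAK4) (t u : Term) :
    Provable T ((Formula.le t u).imp ((Formula.le t.succ u).or (Formula.eq t u))) := by
  have h : Provable T ((Formula.le (var 0) (var 1)).imp
      ((Formula.le (var 0).succ (var 1)).or (Formula.eq (var 0) (var 1)))) := by
    apply pLeE hT (by simp [Term.fv]) (by simp [Term.fv]) (by simp [Formula.fv, Term.fv])
    apply casesRule hT 2
    · apply complete
      intro M hM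
      simp [Formula.subst, Formula.substAll, Term.substAll, hM.imp, hM.or]
      intro h
      right
      exact hM.trans (hM.symm (hM.addZero hT _)) h
    · apply complete
      intro M hM
      simp [Formula.subst, Formula.substAll, Term.substAll, hM.imp, hM.or]
      intro h
      left
      exact (hM.imp _ _).1 (hM.prov (pLeI hT _ _ (var 2)))
        (hM.trans (hM.prov (pSuccAdd hT _ _)) (hM.trans (hM.symm (hM.addSucc hT _ _)) h))
  simpa [Formula.substAll, Term.substAll, sub3] using h.inst3 (by simp [qf]) t u t

/-! Boxed atomic formulas -/

theorem doubleInd (hT : Extends T PAK4) {C : Formula} (hq : C.qf)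
    (h0 : Provable T (C.substAll (sub3 .zero (var 1) (var 2))))
    (hz : Provable T (C.substAll (sub3 (var 0).succ .zero (var 2))))
    (hs : Provable T (C.imp (C.substAll (sub3 (var 0).succ (var 1).succ (var 2))))) :
    Provable T C := by
  have e : ∀ s : Term, (Formula.all 1 C).subst 0 s
      = Formula.all 1 (C.substAll (sub3 s (var 1) (var 2))) := by
    intro s
    simp only [Formula.subst, Formula.substAll]
    congr 2
    funext x
    rcases x with _ | _ | _ | x <;> simp [sub3, Function.update]
  have e2 : ∀ s : Term, (C.substAll (sub3 (var 0).succ (var 1) (var 2))).subst 1 s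
      = C.substAll (sub3 (var 0).succ s (var 2)) := by
    intro s
    simp only [Formula.subst]
    rw [hq.comp]
    congr 1
    funext x
    rcases x with _ | _ | _ | x <;> simp [sub3, Function.update, Term.substAll]
  refine Provable.mp (allSelf 1 C) ?_
  apply indRule hT 0
  · rw [e]
    exact .gen 1 h0
  · rw [e]
    apply Provable.genImp (by simp [Formula.fv])
    have e3 : ∀ s : Term, (Formula.all 1 C).subst 1 s = Formula.all 1 C := fun s =>
      Formula.subst_of_not_fv (by simp [Formula.fv])
    have e4 : ∀ s : Term, ((Formula.all 1 C).imp
        (C.substAll (sub3 (var 0).succ (var 1) (var 2)))).subst 1 s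
        = (Formula.all 1 C).imp (C.substAll (sub3 (var 0).succ s (var 2))) := by
      intro s
      change Formula.imp ((Formula.all 1 C).subst 1 s)
        ((C.substAll (sub3 (var 0).succ (var 1) (var 2))).subst 1 s) = _
      rw [e2, e3]
    apply casesRule hT 1
    · rw [e4]
      exact .mp (.logic (.imp1 _ _)) hz
    · rw [e4]
      apply complete
      intro M hM
      have h1 := hM.prov hs
      have h2 := hM.prov (allSelf (T := T) 1 C)
      simp only [hM.imp] at *
      tauto

theorem boxEq (hT : Extends T PAK4) (t u : Term) :
    Provable T ((Formula.eq t u).imp (Formula.box (Formula.eq t u))) := by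
  have h : Provable T ((Formula.eq (var 0) (var 1)).imp
      (Formula.box (Formula.eq (var 0) (var 1)))) := by
    apply doubleInd hT (by simp [qf])
    · simp [Formula.substAll, Term.substAll, sub3]
      apply casesRule hT 1
      · simp [Formula.subst, Formula.substAll, Term.substAll]
        exact .mp (.logic (.imp1 _ _)) (.nec (.logic (.eqRefl _)))
      · simp [Formula.subst, Formula.substAll, Term.substAll]
        apply complete
        intro M hM
        simp only [hM.imp]
        intro h
        exact (hM.succNe hT (hM.symm h)).elim
    · simp [Formula.substAll, Term.substAll, sub3]
      apply complete
      intro M hM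
      simp only [hM.imp]
      intro h
      exact (hM.succNe hT h).elim
    · simp [Formula.substAll, Term.substAll, sub3]
      apply complete
      intro M hM
      have h1 := hM.prov (bmono hT (.logic (.eqSucc (var 0) (var 1))))
      simp only [hM.imp] at *
      intro h h2
      exact h1 (h (hM.succInj hT h2))
  simpa [Formula.substAll, Term.substAll, sub3] using h.inst3 (by simp [qf]) t u t

theorem contra {φ ψ : Formula} (h : Provable T (φ.imp ψ)) : Provable T (ψ.neg.imp φ.neg) := by
  apply complete
  intro M hM
  have h1 := hM.prov h
  simp only [hM.imp, hM.neg] at *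
  tauto

theorem boxNe (hT : Extends T PAK4) (t u : Term) :
    Provable T ((Formula.eq t u).neg.imp (Formula.box (Formula.eq t u).neg)) := by
  have h : Provable T ((Formula.eq (var 0) (var 1)).neg.imp
      (Formula.box (Formula.eq (var 0) (var 1)).neg)) := by
    apply doubleInd hT (by simp [qf])
    · simp [Formula.substAll, Term.substAll, sub3]
      apply casesRule hT 1
      · simp [Formula.subst, Formula.substAll, Term.substAll]
        apply complete
        intro M hM
        simp only [hM.imp, hM.neg]
        exact fun h => (h (hM.refl _)).elim
      · simp [Formula.subst, Formula.substAll, Term.substAll]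
        refine .mp (.logic (.imp1 _ _)) (.nec ?_)
        exact .mp (contra (.logic (.eqSymm _ _))) (pSuccNeZero hT _)
    · simp [Formula.substAll, Term.substAll, sub3]
      exact .mp (.logic (.imp1 _ _)) (.nec (pSuccNeZero hT _))
    · simp [Formula.substAll, Term.substAll, sub3]
      apply complete
      intro M hM
      have h1 := hM.prov (bmono hT (contra (pSuccInj hT (var 0) (var 1))))
      have h2 := hM.prov (Provable.logic (T := T) (.eqSucc (var 0) (var 1)))
      simp only [hM.imp, hM.neg] at *
      tauto
  simpa [Formula.substAll, Term.substAll, sub3] using h.inst3 (by simp [qf]) t u t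

theorem boxLe (hT : Extends T PAK4) (t u : Term) :
    Provable T ((Formula.le t u).imp (Formula.box (Formula.le t u))) := by
  have h : Provable T ((Formula.le (var 0) (var 1)).imp
      (Formula.box (Formula.le (var 0) (var 1)))) := by
    apply pLeE hT (by simp [Term.fv]) (by simp [Term.fv]) (by simp [Formula.fv, Term.fv])
    apply complete
    intro M hM
    have h1 := hM.prov (boxEq hT ((var 0).add (var 2)) (var 1))
    have h2 := hM.prov (bmono hT (pLeI hT (var 0) (var 1) (var 2)))
    simp only [hM.imp] at *
    tauto
  simpa [Formula.substAll, Term.substAll, sub3] using h.inst3 (by simp [qf]) t u t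

theorem boxNle (hT : Extends T PAK4) (t u : Term) :
    Provable T ((Formula.le t u).neg.imp (Formula.box (Formula.le t u).neg)) := by
  have h : Provable T ((Formula.le (var 0) (var 1)).neg.imp
      (Formula.box (Formula.le (var 0) (var 1)).neg)) := by
    apply doubleInd hT (by simp [qf])
    · simp [Formula.substAll, Term.substAll, sub3]
      apply complete
      intro M hM
      have := hM.prov (pZeroLe hT (var 1))
      simp only [hM.imp, hM.neg]
      tauto
    · simp [Formula.substAll, Term.substAll, sub3]
      exact .mp (.logic (.imp1 _ _)) (.nec (pNotSuccLeZero hT _))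
    · simp [Formula.substAll, Term.substAll, sub3]
      apply complete
      intro M hM
      have h1 := hM.prov (bmono hT (contra (pLeOfSucc hT (var 0) (var 1))))
      have h2 := hM.prov (pSuccLeSucc hT (var 0) (var 1))
      simp only [hM.imp, hM.neg] at *
      tauto
  simpa [Formula.substAll, Term.substAll, sub3] using h.inst3 (by simp [qf]) t u t

/-! Leibniz -/

theorem leibTerm (x y : ℕ) (t : Term) : Provable T ((Formula.eq (var x) (var y)).imp
    (Formula.eq t (t.substAll (Function.update Term.var x (var y))))) := by
  apply complete
  intro M hM
  simp only [hM.imp]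
  intro h
  induction t with
  | var z =>
    by_cases hz : z = x
    · subst hz; simpa [Term.substAll] using h
    · simpa [Term.substAll, Function.update_of_ne hz] using hM.refl _
  | zero => exact hM.refl _
  | succ t ih => exact hM.succ ih
  | add t u ih1 ih2 => exact hM.add ih1 ih2
  | mul t u ih1 ih2 =>
    exact (hM.imp _ _).1 ((hM.imp _ _).1 (hM.prov (.logic (.eqMul _ _ _ _))) ih1) ih2

theorem allMono {γ φ ψ : Formula} {x : ℕ} (hx : x ∉ γ.fv) (h : Provable T (γ.imp (φ.imp ψ))) :
    Provable T (γ.imp ((Formula.all x φ).imp (Formula.all x ψ))) := by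
  have h1 : Provable T ((γ.and (.all x φ)).imp ψ) := by
    apply complete
    intro M hM
    have h1 := hM.prov h
    have h2 := hM.prov (allSelf (T := T) x φ)
    simp only [hM.imp, hM.and] at *
    tauto
  have h2 := h1.genImp (x := x) (by simp [Formula.fv, hx])
  apply complete
  intro M hM
  have h2 := hM.prov h2
  simp only [hM.imp, hM.and] at *
  tauto

theorem exMono {γ φ ψ : Formula} {x : ℕ} (hx : x ∉ γ.fv) (h : Provable T (γ.imp (φ.imp ψ))) :
    Provable T (γ.imp ((Formula.ex x φ).imp (Formula.ex x ψ))) := by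
  have h1 : Provable T (φ.imp (γ.imp (.ex x ψ))) := by
    apply complete
    intro M hM
    have h1 := hM.prov h
    have h2 := hM.prov (exSelf (T := T) x ψ)
    simp only [hM.imp] at *
    tauto
  have h2 := h1.exImp (x := x) (by simp [Formula.fv, hx])
  apply complete
  intro M hM
  have h2 := hM.prov h2
  simp only [hM.imp] at *
  tauto

set_option maxHeartbeats 1000000 in
theorem leib (hT : Extends T PAK4) (x y : ℕ) (φ : Formula) (hf : φ.freeFor (var y) x) :
    Provable T ((Formula.eq (var x) (var y)).imp (φ.imp (φ.subst x (var y)))) ∧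
    Provable T ((Formula.eq (var x) (var y)).imp ((φ.subst x (var y)).imp φ)) := by
  have triv : ∀ ψ : Formula, ψ.subst x (var y) = ψ →
      Provable T ((Formula.eq (var x) (var y)).imp (ψ.imp (ψ.subst x (var y)))) ∧
      Provable T ((Formula.eq (var x) (var y)).imp ((ψ.subst x (var y)).imp ψ)) := by
    intro ψ h
    rw [h]
    constructor <;>
    · apply complete
      intro M hM
      simp only [hM.imp]
      tauto
  induction φ with
  | falsum => exact triv _ rfl
  | eq t u =>
    constructor <;>
    · apply complete
      intro M hM
      have h1 := hM.prov (leibTerm (T := T) x y t)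
      have h2 := hM.prov (leibTerm (T := T) x y u)
      simp only [hM.imp, Formula.subst, Formula.substAll] at *
      intro h h'
      first
      | exact hM.trans (hM.symm (h1 h)) (hM.trans h' (h2 h))
      | exact hM.trans (h1 h) (hM.trans h' (hM.symm (h2 h)))
  | le t u =>
    constructor <;>
    · apply complete
      intro M hM
      have h1 := hM.prov (leibTerm (T := T) x y t)
      have h2 := hM.prov (leibTerm (T := T) x y u)
      simp only [hM.imp, Formula.subst, Formula.substAll] at *
      intro h h'
      first
      | exact hM.le (h1 h) (h2 h) h'
      | exact hM.le (hM.symm (h1 h)) (hM.symm (h2 h)) h'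
  | and φ ψ ih1 ih2 | or φ ψ ih1 ih2 | imp φ ψ ih1 ih2 =>
    obtain ⟨a, b⟩ := ih1 hf.1
    obtain ⟨c, d⟩ := ih2 hf.2
    constructor <;>
    · apply complete
      intro M hM
      have a := hM.prov a
      have b := hM.prov b
      have c := hM.prov c
      have d := hM.prov d
      simp only [hM.imp, hM.and, hM.or, Formula.subst, Formula.substAll] at a b c d ⊢
      intro h
      have a := a h
      have b := b h
      have c := c h
      have d := d h
      first
      | exact fun k => ⟨a k.1, c k.2⟩
      | exact fun k => ⟨b k.1, d k.2⟩
      | exact fun k => Or.imp a c k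
      | exact fun k => Or.imp b d k
      | exact fun k r => c (k (b r))
      | exact fun k r => d (k (a r))
  | neg φ ih =>
    obtain ⟨a, b⟩ := ih hf
    constructor <;>
    · apply complete
      intro M hM
      have a := hM.prov a
      have b := hM.prov b
      simp only [hM.imp, hM.neg, Formula.subst, Formula.substAll] at *
      tauto
  | box φ ih =>
    obtain ⟨a, b⟩ := ih hf
    constructor <;>
    · apply complete
      intro M hM
      have a := hM.prov (bmono2 hT a)
      have b := hM.prov (bmono2 hT b)
      have c := hM.prov (boxEq hT (var x) (var y))
      simp only [hM.imp, Formula.subst, Formula.substAll] at *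
      tauto
  | all z φ ih =>
    rcases hf with h | h | ⟨h, h'⟩
    · exact triv _ (Formula.subst_of_not_fv (by simp [Formula.fv, h]))
    · exact triv _ (Formula.subst_of_not_fv (by simp [Formula.fv, h]))
    by_cases hxz : x = z
    · exact triv _ (Formula.subst_of_not_fv (by simp [Formula.fv, hxz]))
    have e : (Formula.all z φ).subst x (var y) = Formula.all z (φ.subst x (var y)) := by
      simp only [Formula.subst, Formula.substAll]
      congr 2
      rw [Function.update_comm hxz]
      simp
    rw [e]
    have hz : z ∉ (Formula.eq (var x) (var y)).fv := by
      simp [Formula.fv, Term.fv] at h ⊢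
      tauto
    exact ⟨allMono hz (ih h').1, allMono hz (ih h').2⟩
  | ex z φ ih =>
    rcases hf with h | h | ⟨h, h'⟩
    · exact triv _ (Formula.subst_of_not_fv (by simp [Formula.fv, h]))
    · exact triv _ (Formula.subst_of_not_fv (by simp [Formula.fv, h]))
    by_cases hxz : x = z
    · exact triv _ (Formula.subst_of_not_fv (by simp [Formula.fv, hxz]))
    have e : (Formula.ex z φ).subst x (var y) = Formula.ex z (φ.subst x (var y)) := by
      simp only [Formula.subst, Formula.substAll]
      congr 2
      rw [Function.update_comm hxz]
      simp
    rw [e]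
    have hz : z ∉ (Formula.eq (var x) (var y)).fv := by
      simp [Formula.fv, Term.fv] at h ⊢
      tauto
    exact ⟨exMono hz (ih h').1, exMono hz (ih h').2⟩

/-! Bounded Barcan -/

theorem ball_subst {x y : ℕ} (hxy : y ≠ x) {φ : Formula} (hy : y ∉ φ.fv) (r s : Term) :
    (Formula.all x ((Formula.le (var x).succ r).imp φ)).subst y s =
      Formula.all x ((Formula.le (var x).succ
        (r.substAll (Function.update Term.var y s))).imp φ) := by
  have e : Function.update (Function.update Term.var y s) x (var x)
      = Function.update Term.var y s := by
    rw [Function.update_comm hxy]; simp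
  have e2 : φ.substAll (Function.update Term.var y s) = φ := Formula.subst_of_not_fv hy
  simp [Formula.subst, Formula.substAll, Term.substAll, e, e2]

theorem barcan (hT : Extends T PAK4) (x : ℕ) (t : Term) (hxt : x ∉ t.fv) (φ : Formula) :
    Provable T ((Formula.ball x t (Formula.box φ)).imp (Formula.box (Formula.ball x t φ))) := by
  obtain ⟨N, hN⟩ := φ.exists_fresh x
  obtain ⟨y, hyN, hyx'⟩ : ∃ y, N ≤ y ∧ x < y := ⟨max N (x + 1), by omega, by omega⟩
  have hyx : y ≠ x := by omega
  obtain ⟨hy, hf⟩ := hN y hyN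
  simp only [Formula.ball, Formula.lt]
  let B : Term → Formula → Formula := fun s ψ =>
    Formula.all x ((Formula.le (var x).succ s).imp ψ)
  have eB : ∀ (ψ : Formula), y ∉ ψ.fv → ∀ s : Term, (B (var y) ψ).subst y s = B s ψ := by
    intro ψ hψ s
    simp only [B]
    rw [ball_subst hyx hψ]
    simp [Term.substAll]
  have hyb : y ∉ (Formula.box φ).fv := hy
  have e : ∀ s : Term, ((B (var y) (.box φ)).imp (.box (B (var y) φ))).subst y s =
      (B s (.box φ)).imp (.box (B s φ)) := by
    intro s
    change Formula.imp ((B (var y) (.box φ)).subst y s) (.box ((B (var y) φ).subst y s)) = _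
    rw [eB _ hyb, eB _ hy]
  have main : Provable T ((B (var y) (.box φ)).imp (.box (B (var y) φ))) := by
    apply indRule hT y
    · rw [e]
      refine .mp (.logic (.imp1 _ _)) (.nec (.gen x ?_))
      exact .mp (.logic (.negE _ _)) (pNotSuccLeZero hT _)
    · rw [e]
      have xB : ∀ s ψ, x ∉ (B s ψ).fv := by simp [B, Formula.fv]
      have s1 : Provable T ((B (var y).succ (.box φ)).imp (B (var y) (.box φ))) := by
        apply Provable.genImp (xB _ _)
        apply complete
        intro M hM
        have h1 := hM.prov (allSelf (T := T) x
          ((Formula.le (var x).succ (var y).succ).imp (.box φ)))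
        have h2 := hM.prov (pLeSucc hT (var x).succ (var y))
        simp only [hM.imp, B] at *
        tauto
      have s2 : Provable T ((B (var y).succ (.box φ)).imp (.box (φ.subst x (var y)))) := by
        have h1 := LogicalAxiom.allE x (var y)
          ((Formula.le (var x).succ (var y).succ).imp (.box φ)) ⟨trivial, hf⟩
        have h2 : Provable T _ := .logic h1
        apply complete
        intro M hM
        have h2 := hM.prov h2
        have h3 := hM.prov (pLeRefl hT (var y).succ)
        simp [hM.imp, B, Formula.subst, Formula.substAll, Term.substAll,
          Function.update_of_ne hyx] at *
        tauto
      have s3 : Provable T ((B (var y) φ).imp ((φ.subst x (var y)).imp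
          (B (var y).succ φ))) := by
        have h1 : Provable T (((B (var y) φ).and (φ.subst x (var y))).imp
            (B (var y).succ φ)) := by
          apply Provable.genImp
          · have := xB (var y) φ
            have h2 : x ∉ (φ.subst x (var y)).fv :=
              Formula.not_fv_subst (by simpa [Term.fv] using hyx.symm)
            simp only [Formula.fv, Finset.mem_union, not_or]
            exact ⟨this, h2⟩
          · apply complete
            intro M hM
            have h1 := hM.prov (allSelf (T := T) x
              ((Formula.le (var x).succ (var y)).imp φ))
            have h2 := hM.prov (pLeOfSucc hT (var x) (var y))
            have h3 := hM.prov (pLeCases hT (var x) (var y))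
            have h4 := hM.prov (leib hT x y φ hf).2
            simp only [hM.imp, hM.and, hM.or, B] at *
            tauto
        apply complete
        intro M hM
        have h1 := hM.prov h1
        simp only [hM.imp, hM.and] at *
        tauto
      apply complete
      intro M hM
      have s1 := hM.prov s1
      have s2 := hM.prov s2
      have s3 := hM.prov (bmono2 hT s3)
      simp only [hM.imp] at *
      tauto
  have h := main.inst y t (by
    have hft : φ.freeFor t y := Formula.freeFor_of_not_fv hy
    simp [B, freeFor, hxt, hft])
  rw [e] at h
  exact h

/-! Completeness -/

theorem boxEx (hT : Extends T PAK4) {x : ℕ} {φ : Formula}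
    (h : Provable T (φ.imp (.box φ))) :
    Provable T ((Formula.ex x φ).imp (.box (Formula.ex x φ))) := by
  apply Provable.exImp (by simp [Formula.fv])
  apply complete
  intro M hM
  have h1 := hM.prov h
  have h2 := hM.prov (bmono hT (exSelf (T := T) x φ))
  simp only [hM.imp] at *
  tauto

theorem boxAnd (hT : Extends T PAK4) {φ ψ : Formula}
    (h : Provable T (φ.imp (.box φ))) (h' : Provable T (ψ.imp (.box ψ))) :
    Provable T ((φ.and ψ).imp (.box (φ.and ψ))) := by
  apply complete
  intro M hM
  have h1 := hM.prov h
  have h2 := hM.prov h'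
  have h3 := hM.prov (bmono2 hT (.logic (.andI φ ψ)))
  simp only [hM.imp, hM.and] at *
  tauto

theorem boxOr (hT : Extends T PAK4) {φ ψ : Formula}
    (h : Provable T (φ.imp (.box φ))) (h' : Provable T (ψ.imp (.box ψ))) :
    Provable T ((φ.or ψ).imp (.box (φ.or ψ))) := by
  apply complete
  intro M hM
  have h1 := hM.prov h
  have h2 := hM.prov h'
  have h3 := hM.prov (bmono hT (.logic (.orI1 φ ψ)))
  have h4 := hM.prov (bmono hT (.logic (.orI2 φ ψ)))
  simp only [hM.imp, hM.or] at *
  tauto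

theorem boxBall (hT : Extends T PAK4) {x : ℕ} {t : Term} (hx : x ∉ t.fv) {φ : Formula}
    (h : Provable T (φ.imp (.box φ))) :
    Provable T ((Formula.ball x t φ).imp (.box (Formula.ball x t φ))) := by
  have h1 : Provable T ((Formula.ball x t φ).imp (Formula.ball x t (.box φ))) := by
    apply Provable.genImp (by simp [Formula.fv, Formula.ball])
    apply complete
    intro M hM
    have h1 := hM.prov h
    have h2 := hM.prov (allSelf (T := T) x ((Formula.lt (var x) t).imp φ))
    simp only [hM.imp, Formula.ball] at *
    tauto
  apply complete
  intro M hM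
  have h1 := hM.prov h1
  have h2 := hM.prov (barcan hT x t hx φ)
  simp only [hM.imp] at *
  tauto

/-- transfer along provable equivalence -/
theorem boxCongr (hT : Extends T PAK4) {φ ψ : Formula} (h1 : Provable T (φ.imp ψ))
    (h2 : Provable T (ψ.imp φ)) (h : Provable T (φ.imp (.box φ))) :
    Provable T (ψ.imp (.box ψ)) := by
  apply complete
  intro M hM
  have h1 := hM.prov (bmono hT h1)
  have h2 := hM.prov h2
  have h := hM.prov h
  simp only [hM.imp] at *
  tauto

theorem negBall {x : ℕ} {t : Term} {φ : Formula} :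
    Provable T ((Formula.bex x t φ.neg).imp (Formula.ball x t φ).neg) ∧
    Provable T ((Formula.ball x t φ).neg.imp (Formula.bex x t φ.neg)) := by
  constructor
  · apply Provable.exImp (by simp [Formula.fv, Formula.ball])
    apply complete
    intro M hM
    have h2 := hM.prov (allSelf (T := T) x ((Formula.lt (var x) t).imp φ))
    simp only [hM.imp, hM.and, hM.neg, Formula.ball] at *
    tauto
  · have h : Provable T ((Formula.bex x t φ.neg).neg.imp (Formula.ball x t φ)) := by
      apply Provable.genImp (by simp [Formula.fv, Formula.bex])
      apply complete
      intro M hM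
      have h2 := hM.prov (exSelf (T := T) x ((Formula.lt (var x) t).and φ.neg))
      simp only [hM.imp, hM.and, hM.neg, Formula.bex] at *
      tauto
    apply complete
    intro M hM
    have h := hM.prov h
    simp only [hM.imp, hM.neg] at *
    tauto

theorem negBex {x : ℕ} {t : Term} {φ : Formula} :
    Provable T ((Formula.ball x t φ.neg).imp (Formula.bex x t φ).neg) ∧
    Provable T ((Formula.bex x t φ).neg.imp (Formula.ball x t φ.neg)) := by
  constructor
  · have h : Provable T ((Formula.bex x t φ).imp (Formula.ball x t φ.neg).neg) := by
      apply Provable.exImp (by simp [Formula.fv, Formula.ball])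
      apply complete
      intro M hM
      have h2 := hM.prov (allSelf (T := T) x ((Formula.lt (var x) t).imp φ.neg))
      simp only [hM.imp, hM.and, hM.neg, Formula.ball] at *
      tauto
    apply complete
    intro M hM
    have h := hM.prov h
    simp only [hM.imp, hM.neg] at *
    tauto
  · apply Provable.genImp (by simp [Formula.fv, Formula.bex])
    apply complete
    intro M hM
    have h2 := hM.prov (exSelf (T := T) x ((Formula.lt (var x) t).and φ))
    simp only [hM.imp, hM.and, hM.neg, Formula.bex] at *
    tauto

theorem boxDelta0 (hT : Extends T PAK4) {φ : Formula} (h : IsDelta0 φ) :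
    Provable T (φ.imp (.box φ)) ∧ Provable T (φ.neg.imp (.box φ.neg)) := by
  have taut : ∀ {φ : Formula}, (∀ M, MCS T M → M φ) → Provable T φ := complete
  induction h with
  | falsum =>
    refine ⟨.logic (.falsumE _), .mp (.logic (.imp1 _ _)) (.nec (taut fun M hM => ?_))⟩
    exact (hM.neg _).2 hM.falsum
  | eq t u => exact ⟨boxEq hT t u, boxNe hT t u⟩
  | le t u => exact ⟨boxLe hT t u, boxNle hT t u⟩
  | @and φ ψ _ _ ih1 ih2 =>
    refine ⟨boxAnd hT ih1.1 ih2.1, boxCongr hT (φ := φ.neg.or ψ.neg) ?_ ?_ (boxOr hT ih1.2 ih2.2)⟩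
    all_goals
      apply complete
      intro M hM
      simp only [hM.imp, hM.neg, hM.and, hM.or]
      tauto
  | @or φ ψ _ _ ih1 ih2 =>
    refine ⟨boxOr hT ih1.1 ih2.1, boxCongr hT (φ := φ.neg.and ψ.neg) ?_ ?_ (boxAnd hT ih1.2 ih2.2)⟩
    all_goals
      apply complete
      intro M hM
      simp only [hM.imp, hM.neg, hM.and, hM.or]
      tauto
  | @imp φ ψ _ _ ih1 ih2 =>
    refine ⟨boxCongr hT (φ := φ.neg.or ψ) ?_ ?_ (boxOr hT ih1.2 ih2.1),
      boxCongr hT (φ := φ.and ψ.neg) ?_ ?_ (boxAnd hT ih1.1 ih2.2)⟩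
    all_goals
      apply complete
      intro M hM
      simp only [hM.imp, hM.neg, hM.and, hM.or]
      tauto
  | @neg φ _ ih =>
    refine ⟨ih.2, boxCongr hT (φ := φ) ?_ ?_ ih.1⟩
    all_goals
      apply complete
      intro M hM
      simp only [hM.imp, hM.neg]
      tauto
  | ball hx _ ih =>
    exact ⟨boxBall hT hx ih.1,
      boxCongr hT negBall.1 negBall.2 (boxEx hT (boxAnd hT (boxLe hT _ _) ih.2))⟩
  | bex hx _ ih =>
    exact ⟨boxEx hT (boxAnd hT (boxLe hT _ _) ih.1),
      boxCongr hT negBex.1 negBex.2 (boxBall hT hx ih.2)⟩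

theorem boxSigma1 (hT : Extends T PAK4) {φ : Formula} (h : IsSigma1 φ) :
    Provable T (φ.imp (.box φ)) := by
  induction h with
  | delta0 h => exact (boxDelta0 hT h).1
  | and _ _ ih1 ih2 => exact boxAnd hT ih1 ih2
  | or _ _ ih1 ih2 => exact boxOr hT ih1 ih2
  | ex _ ih => exact boxEx hT ih
  | ball hx _ ih => exact boxBall hT hx ih

theorem boxSigmaB (hT : Extends T PAK4) {φ : Formula} (h : IsSigmaB φ) :
    Provable T (φ.imp (.box φ)) := by
  induction h with
  | sigma1 h => exact boxSigma1 hT h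
  | b ψ => exact fourProv hT ψ
  | and _ _ ih1 ih2 => exact boxAnd hT ih1 ih2
  | or _ _ ih1 ih2 => exact boxOr hT ih1 ih2
  | ex _ ih => exact boxEx hT ih
  | ball hx _ ih => exact boxBall hT hx ih

/-! Iterated conjunctions -/

theorem conj_sigmaB : ∀ l : List Formula, (∀ σ ∈ l, IsSigmaB σ ∧ Sentence σ) →
    IsSigmaB (conj l) ∧ Sentence (conj l)
  | [], _ => ⟨.sigma1 (.delta0 (.neg .falsum)), rfl⟩
  | [φ], h => h φ (by simp)
  | φ :: ψ :: l, h => by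
    have h1 := h φ (by simp)
    have h2 := conj_sigmaB (ψ :: l) fun σ hσ => h σ (List.mem_cons_of_mem _ hσ)
    refine ⟨.and h1.1 h2.1, ?_⟩
    have a := h1.2
    have b := h2.2
    simp only [Sentence, conj, Formula.fv] at *
    rw [a, b]
    rfl

theorem MCS.conj {M : Formula → Prop} (hM : MCS T M) :
    ∀ l : List Formula, M (conj l) ↔ ∀ σ ∈ l, M σ
  | [] => by
    simpa [ModalArith.conj, hM.neg] using hM.falsum
  | [φ] => by simp [ModalArith.conj]
  | φ :: ψ :: l => by
    rw [ModalArith.conj, hM.and, hM.conj (ψ :: l)]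
    simp

end

/-- ΣB-deduction theorem: if T extends PA(K4), X is a set of ΣB sentences and
T + X ⊢ φ, then T ⊢ σ₀ ∧ ⋯ ∧ σ_{k-1} → φ for some σ₀, …, σ_{k-1} ∈ X. -/
theorem statement8 (T X : Set Formula) (hT : Extends T PAK4)
    (hX : ∀ σ ∈ X, IsSigmaB σ ∧ Sentence σ) (φ : Formula)
    (h : Provable (T ∪ X) φ) :
    ∃ l : List Formula, (∀ σ ∈ l, σ ∈ X) ∧ Provable T ((conj l).imp φ) := by
  induction h with
  | @ax φ h =>
    rcases h with h | h
    · exact ⟨[], by simp, .mp (.logic (.imp1 _ _)) (.ax h)⟩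
    · refine ⟨[φ], by simpa using h, ?_⟩
      apply complete
      intro M hM
      simp [hM.imp, conj]
  | logic h => exact ⟨[], by simp, .mp (.logic (.imp1 _ _)) (.logic h)⟩
  | mp _ _ ih1 ih2 =>
    obtain ⟨l1, hl1, h1⟩ := ih1
    obtain ⟨l2, hl2, h2⟩ := ih2
    refine ⟨l1 ++ l2, ?_, ?_⟩
    · intro σ hσ
      rcases List.mem_append.1 hσ with h | h
      · exact hl1 σ h
      · exact hl2 σ h
    · apply complete
      intro M hM
      have h1 := hM.prov h1
      have h2 := hM.prov h2
      simp only [hM.imp, hM.conj, List.mem_append] at *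
      intro h
      exact h1 (fun σ hσ => h σ (.inl hσ)) (h2 fun σ hσ => h σ (.inr hσ))
  | gen x _ ih =>
    obtain ⟨l, hl, h⟩ := ih
    refine ⟨l, hl, .genImp ?_ h⟩
    have := (conj_sigmaB l fun σ hσ => hX σ (hl σ hσ)).2
    rw [Sentence] at this
    simp [this]
  | nec _ ih =>
    obtain ⟨l, hl, h⟩ := ih
    refine ⟨l, hl, ?_⟩
    have h1 := boxSigmaB hT (conj_sigmaB l fun σ hσ => hX σ (hl σ hσ)).1
    apply complete
    intro M hM
    have h1 := hM.prov h1
    have h := hM.prov (bmono hT h)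
    simp only [hM.imp] at *
    tauto

end ModalArith
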